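/- arXiv:1012.2944 — 2 statements merged into one kernel-verified Lean document; each statement's English description precedes it below -/
import Mathlib

section
/- Let s ≥ 0. There is a constant C, depending only on s and d, such that for all f, g ∈ H^s(T^d) ∩ L^∞(T^d), ‖fg‖_{H^s} ≤ C(‖f‖_{L^∞}‖g‖_{H^s} + ‖f‖_{H^s}‖g‖_{L^∞}). -/
open MeasureTheory Complex Real

noncomputable section

abbrev Td (d : ℕ) := Fin d → ℝ

def box (d : ℕ) : Set (Td d) := Set.univ.pi fun _ => Set.Ioc (0:ℝ) 1

/-- `f` is `ℤ^d`-periodic. -/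
def TPer {d : ℕ} (f : Td d → ℝ) : Prop :=
  ∀ (x : Td d) (k : Fin d → ℤ), f (fun i => x i + k i) = f x

/-- The character `e^{2π i k·x}`. -/
def eK {d : ℕ} (k : Fin d → ℤ) (x : Td d) : ℂ :=
  Complex.exp (2 * Real.pi * Complex.I * ∑ i, (k i : ℂ) * (x i : ℂ))

/-- Fourier coefficient of a periodic function on the torus. -/
def fCoeff {d : ℕ} (f : Td d → ℝ) (k : Fin d → ℤ) : ℂ :=
  ∫ x in box d, (f x : ℂ) * Complex.exp (-(2 * Real.pi * Complex.I) * ∑ i, (k i : ℂ) * (x i : ℂ))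

/-- Japanese bracket weight `(1+|k|²)^s`. -/
def wt {d : ℕ} (s : ℝ) (k : Fin d → ℤ) : ℝ := (1 + ∑ i, ((k i : ℝ))^2) ^ s

def hsNormSq {d : ℕ} (s : ℝ) (f : Td d → ℝ) : ℝ :=
  ∑' k : Fin d → ℤ, wt s k * ‖fCoeff f k‖^2

/-- Sobolev `H^s` norm on the torus, via Fourier series. -/
def hsNorm {d : ℕ} (s : ℝ) (f : Td d → ℝ) : ℝ := Real.sqrt (hsNormSq s f)

/-- Membership in `H^s`. -/
def InHs {d : ℕ} (s : ℝ) (f : Td d → ℝ) : Prop :=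
  Summable fun k : Fin d → ℤ => wt s k * ‖fCoeff f k‖^2

def l2Norm {d : ℕ} (f : Td d → ℝ) : ℝ := Real.sqrt (∫ x in box d, (f x)^2)

def l2NormC {d : ℕ} (f : Td d → ℂ) : ℝ := Real.sqrt (∫ x in box d, ‖f x‖^2)

def linf {d : ℕ} (f : Td d → ℝ) : ℝ := ⨆ x : Td d, |f x|

/-- `i`-th partial derivative. -/
def pd {d : ℕ} (i : Fin d) (f : Td d → ℝ) (x : Td d) : ℝ := fderiv ℝ f x (Pi.single i 1)

/-- Laplacian. -/
def lap {d : ℕ} (f : Td d → ℝ) (x : Td d) : ℝ := ∑ i, pd i (pd i f) x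

/-- Pointwise Euclidean norm of the gradient. -/
def gn {d : ℕ} (f : Td d → ℝ) (x : Td d) : ℝ := Real.sqrt (∑ i, (pd i f x)^2)

attribute [local instance] instMeasureSpaceUnitAddCircle
/-- Fourier coefficient of complex function. -/
def cf {d : ℕ} (h : Td d → ℂ) (k : Fin d → ℤ) : ℂ := ∫ x in box d, h x * eK (-k) x

lemma eK_neg_eq {d : ℕ} (k : Fin d → ℤ) (x : Td d) :
    eK (-k) x = Complex.exp (-(2 * Real.pi * Complex.I) * ∑ i, (k i : ℂ) * (x i : ℂ)) := by
  unfold eK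
  congr 1
  simp [Finset.sum_neg_distrib]

lemma fCoeff_eq_cf {d : ℕ} (f : Td d → ℝ) (k : Fin d → ℤ) :
    fCoeff f k = cf (fun x => (f x : ℂ)) k := by
  unfold fCoeff cf
  simp only [eK_neg_eq]

lemma eK_add {d : ℕ} (k l : Fin d → ℤ) (x : Td d) : eK (k + l) x = eK k x * eK l x := by
  unfold eK
  rw [← Complex.exp_add, ← mul_add, ← Finset.sum_add_distrib]
  simp [add_mul]

lemma eK_zero {d : ℕ} (x : Td d) : eK (0 : Fin d → ℤ) x = 1 := by simp [eK]

lemma eK_sub_arg {d : ℕ} (k : Fin d → ℤ) (x y : Td d) : eK k (x - y) = eK k x * eK (-k) y := by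
  unfold eK
  rw [← Complex.exp_add, ← mul_add, ← Finset.sum_add_distrib]
  congr 2
  apply Finset.sum_congr rfl
  intro i _
  simp; ring

lemma eK_conj {d : ℕ} (k : Fin d → ℤ) (x : Td d) : (starRingEnd ℂ) (eK k x) = eK (-k) x := by
  unfold eK
  rw [← Complex.exp_conj]
  simp [map_sum, Complex.conj_ofNat]

lemma eK_cont {d : ℕ} (k : Fin d → ℤ) : Continuous (eK k : Td d → ℂ) := by
  unfold eK; fun_prop

lemma box_subset (d : ℕ) : box d ⊆ Set.Icc 0 1 := by
  intro x hx
  simp only [box, Set.mem_univ_pi, Set.mem_Ioc] at hx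
  exact ⟨fun i => (hx i).1.le, fun i => (hx i).2⟩

lemma box_meas (d : ℕ) : MeasurableSet (box d) :=
  MeasurableSet.univ_pi fun _ => measurableSet_Ioc

lemma box_eq (d : ℕ) :
    {x : Fin d → ℝ | ∀ i, x i ∈ Set.Ioc ((0 : Fin d → ℝ) i) ((0 : Fin d → ℝ) i + 1)} = box d := by
  ext x; simp [box]

lemma cont_int {d : ℕ} {E : Type*} [NormedAddCommGroup E] {h : Td d → E} (hh : Continuous h) :
    IntegrableOn h (box d) :=
  (hh.continuousOn.integrableOn_compact (isCompact_Icc (a := (0 : Td d)) (b := 1))).mono_set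
    (box_subset d)

lemma box_vol (d : ℕ) : (volume : Measure (Td d)).real (box d) = 1 := by
  simp [box, measureReal_def, volume_pi_pi]

lemma mF_eq {d : ℕ} (k : Fin d → ℤ) (x : Td d) :
    UnitAddTorus.mFourier k (fun i => (x i : UnitAddCircle)) = eK k x := by
  simp only [UnitAddTorus.mFourier, ContinuousMap.coe_mk, fourier_coe_apply, eK]
  rw [← Complex.exp_sum, Finset.mul_sum]
  congr 1
  apply Finset.sum_congr rfl
  intro i _
  simp; ring

lemma parseval {d : ℕ} {h : Td d → ℂ} (hh : Continuous h) :
    HasSum (fun k => ‖cf h k‖ ^ 2) (∫ x in box d, ‖h x‖ ^ 2) := by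
  set F : UnitAddTorus (Fin d) → ℂ := fun t => h (fun i => (AddCircle.equivIoc 1 0 (t i)).1) with hF
  have hFm : Measurable F := by
    refine hh.measurable.comp (measurable_pi_lambda _ fun i => ?_)
    exact measurable_subtype_coe.comp
      ((AddCircle.measurableEquivIoc 1 0).measurable.comp (measurable_pi_apply i))
  have hFe : ∀ x ∈ box d, F (fun i => (x i : UnitAddCircle)) = h x := by
    intro x hx
    simp only [hF]
    congr 1
    funext i
    have hxi : x i ∈ Set.Ioc (0:ℝ) (0+1) := by simpa [box] using hx i (Set.mem_univ i)
    exact AddCircle.equivIoc_coe_of_mem hxi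
  obtain ⟨C, hC⟩ := (isCompact_Icc (a := (0 : Td d)) (b := 1)).exists_bound_of_continuousOn
    hh.continuousOn
  have hFb : ∀ t, ‖F t‖ ≤ C := by
    intro t
    apply hC
    constructor
    · intro i; exact (AddCircle.equivIoc 1 0 (t i)).2.1.le
    · intro i; simpa using (AddCircle.equivIoc 1 0 (t i)).2.2
  have : IsProbabilityMeasure (volume : Measure UnitAddCircle) :=
    inferInstanceAs (IsProbabilityMeasure AddCircle.haarAddCircle)
  have hL : MemLp F 2 (volume : Measure (UnitAddTorus (Fin d))) :=
    MemLp.of_bound hFm.aestronglyMeasurable C (Filter.Eventually.of_forall hFb)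
  have key := UnitAddTorus.hasSum_sq_mFourierCoeff hL.toLp
  have hae := hL.coeFn_toLp
  have h1 : ∫ t, ‖hL.toLp F t‖ ^ 2 = ∫ x in box d, ‖h x‖ ^ 2 := by
    rw [integral_congr_ae (g := fun t => ‖F t‖ ^ 2) (by filter_upwards [hae] with t ht; rw [ht])]
    rw [UnitAddTorus.integral_preimage _ 0, box_eq]
    apply setIntegral_congr_fun (box_meas d)
    intro x hx
    simp only [hFe x hx]
  have h2 : ∀ k, UnitAddTorus.mFourierCoeff (hL.toLp F) k = cf h k := by
    intro k
    unfold cf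
    have : UnitAddTorus.mFourierCoeff (hL.toLp F) k = UnitAddTorus.mFourierCoeff F k := by
      unfold UnitAddTorus.mFourierCoeff
      apply integral_congr_ae
      filter_upwards [hae] with t ht
      rw [ht]
    rw [this, UnitAddTorus.mFourierCoeff_eq_integral _ _ 0, box_eq]
    apply setIntegral_congr_fun (box_meas d)
    intro x hx
    simp only [hFe x hx, mF_eq, smul_eq_mul, mul_comm]
  rw [h1] at key
  simpa only [h2] using key

lemma int_eK {d : ℕ} (k : Fin d → ℤ) : ∫ x in box d, eK k x = if k = 0 then 1 else 0 := by
  have := orthonormal_iff_ite.mp (UnitAddTorus.orthonormal_mFourier (d := Fin d)) 0 k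
  simp only [ContinuousMap.inner_toLp, ← UnitAddTorus.mFourier_neg, ← UnitAddTorus.mFourier_add] at this
  rw [UnitAddTorus.integral_preimage _ 0, box_eq] at this
  simpa [mF_eq, eq_comm] using this
/-- sup norm of a frequency -/
def nrm {d : ℕ} (k : Fin d → ℤ) : ℕ := Finset.univ.sup fun i => (k i).natAbs

/-- frequency cube -/
def cube (d N : ℕ) : Finset (Fin d → ℤ) := Fintype.piFinset fun _ => Finset.Icc (-(N:ℤ)) N

lemma nrm_le {d : ℕ} {k : Fin d → ℤ} {N : ℕ} : nrm k ≤ N ↔ ∀ i, (k i).natAbs ≤ N := by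
  simp [nrm, Finset.sup_le_iff]

lemma mem_cube {d : ℕ} {k : Fin d → ℤ} {N : ℕ} : k ∈ cube d N ↔ nrm k ≤ N := by
  rw [nrm_le]
  simp only [cube, Fintype.mem_piFinset, Finset.mem_Icc]
  refine forall_congr' fun i => ?_
  omega

lemma card_cube (d N : ℕ) : (cube d N).card = (2 * N + 1) ^ d := by
  simp only [cube, Fintype.card_piFinset, Int.card_Icc, Finset.prod_const, Finset.card_univ,
    Fintype.card_fin]
  congr 1
  omega

lemma nrm_add {d : ℕ} (k l : Fin d → ℤ) : nrm (k + l) ≤ nrm k + nrm l := by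
  rw [nrm_le]
  intro i
  have h1 := (nrm_le (k := k)).1 le_rfl i
  have h2 := (nrm_le (k := l)).1 le_rfl i
  simp only [Pi.add_apply]
  omega

lemma nrm_sub {d : ℕ} (k l : Fin d → ℤ) : nrm (k - l) ≤ nrm k + nrm l := by
  rw [nrm_le]
  intro i
  have h1 := (nrm_le (k := k)).1 le_rfl i
  have h2 := (nrm_le (k := l)).1 le_rfl i
  simp only [Pi.sub_apply]
  omega

lemma cf_trig {d : ℕ} {ι : Type*} (I : Finset ι) (c : ι → ℂ) (κ : ι → Fin d → ℤ)
    (k : Fin d → ℤ) :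
    cf (fun x => ∑ i ∈ I, c i * eK (κ i) x) k = ∑ i ∈ I, if κ i = k then c i else 0 := by
  unfold cf
  simp only [Finset.sum_mul, mul_assoc, ← eK_add]
  rw [integral_finsetSum]
  · apply Finset.sum_congr rfl
    intro i _
    rw [integral_const_mul, int_eK]
    simp [add_neg_eq_zero]
  · intro i _
    exact cont_int ((eK_cont _).const_mul _)

lemma cf_sub {d : ℕ} {f g : Td d → ℂ} (hf : Continuous f) (hg : Continuous g) (k : Fin d → ℤ) :
    cf (fun x => f x - g x) k = cf f k - cf g k := by
  unfold cf
  simp only [sub_mul]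
  exact integral_sub (cont_int (hf.mul (eK_cont _))) (cont_int (hg.mul (eK_cont _)))

/-- de la Vallée Poussin type approximation -/
def ap {d : ℕ} (N : ℕ) (f : Td d → ℂ) (x : Td d) : ℂ :=
  ∑ p ∈ cube d N ×ˢ cube d (2 * N),
    (((cube d N).card : ℂ)⁻¹ * cf f (p.2 - p.1)) * eK (p.2 - p.1) x

lemma ap_cont {d : ℕ} (N : ℕ) (f : Td d → ℂ) : Continuous (ap N f) := by
  unfold ap
  exact continuous_finsetSum _ fun p _ => (eK_cont _).const_mul _

lemma card_ne (d N : ℕ) : ((cube d N).card : ℂ) ≠ 0 := by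
  rw [card_cube]; exact_mod_cast (by positivity : (2 * N + 1) ^ d ≠ 0)

lemma cf_ap {d : ℕ} (N : ℕ) (f : Td d → ℂ) (k : Fin d → ℤ) :
    cf f k - cf (ap N f) k =
      cf f k * (((cube d N).card : ℂ)⁻¹ * ∑ b ∈ cube d N, if nrm (k + b) ≤ 2 * N then 0 else 1) := by
  have h1 : cf (ap N f) k =
      ∑ b ∈ cube d N, cf f k * ((cube d N).card : ℂ)⁻¹ *
        (if nrm (k + b) ≤ 2 * N then 1 else 0) := by
    unfold ap
    rw [cf_trig, Finset.sum_product]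
    apply Finset.sum_congr rfl
    intro b _
    have : ∀ a ∈ cube d (2 * N), (if a - b = k then ((cube d N).card : ℂ)⁻¹ * cf f (a - b) else 0)
        = if a = k + b then cf f k * ((cube d N).card : ℂ)⁻¹ else 0 := by
      intro a _
      by_cases h : a - b = k
      · rw [if_pos h, if_pos (sub_eq_iff_eq_add.1 h), h, mul_comm]
      · rw [if_neg h, if_neg (fun hab => h (sub_eq_iff_eq_add.2 hab))]
    dsimp only
    rw [Finset.sum_congr rfl this, Finset.sum_ite_eq']
    simp only [mem_cube]
    split_ifs <;> simp
  have h2 : cf f k = ∑ b ∈ cube d N, cf f k * ((cube d N).card : ℂ)⁻¹ := by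
    rw [Finset.sum_const, nsmul_eq_mul]
    field_simp [card_ne d N]
  rw [h1]
  nth_rw 1 [h2]
  rw [← Finset.sum_sub_distrib, ← mul_assoc, Finset.mul_sum]
  apply Finset.sum_congr rfl
  intro b _
  split_ifs <;> simp

lemma cf_ap_le {d : ℕ} (N : ℕ) (f : Td d → ℂ) (k : Fin d → ℤ) :
    ‖cf f k - cf (ap N f) k‖ ^ 2 ≤ if N < nrm k then ‖cf f k‖ ^ 2 else 0 := by
  rw [cf_ap]
  split_ifs with h
  · rw [norm_mul]
    have : ‖(((cube d N).card : ℂ)⁻¹ *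
        ∑ b ∈ cube d N, if nrm (k + b) ≤ 2 * N then (0:ℂ) else 1)‖ ≤ 1 := by
      rw [norm_mul, norm_inv, Complex.norm_natCast]
      have h0 : (0:ℝ) < (cube d N).card := by rw [card_cube]; positivity
      rw [inv_mul_le_iff₀ h0, mul_one]
      refine (norm_sum_le _ _).trans ?_
      refine (Finset.sum_le_card_nsmul _ _ 1 ?_).trans (by simp)
      intro b _
      split_ifs <;> simp
    apply pow_le_pow_left₀ (by positivity)
    exact mul_le_of_le_one_right (norm_nonneg _) this
  · have : ∑ b ∈ cube d N, (if nrm (k + b) ≤ 2 * N then (0:ℂ) else 1) = 0 := by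
      apply Finset.sum_eq_zero
      intro b hb
      rw [mem_cube] at hb
      have := nrm_add k b
      rw [if_pos (by omega)]
    rw [this]; simp

lemma ap_l2 {d : ℕ} (N : ℕ) {f : Td d → ℂ} (hf : Continuous f) :
    ∫ x in box d, ‖f x - ap N f x‖ ^ 2 ≤ ∑' k, if N < nrm k then ‖cf f k‖ ^ 2 else 0 := by
  have h := parseval (h := fun x => f x - ap N f x) (hf.sub (ap_cont N f))
  rw [← h.tsum_eq]
  have hs : Summable fun k => if N < nrm k then ‖cf f k‖ ^ 2 else 0 := by
    refine Summable.of_nonneg_of_le ?_ ?_ (parseval hf).summable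
    · intro k; split_ifs <;> positivity
    · intro k; split_ifs
      · exact le_rfl
      · positivity
  refine h.summable.tsum_le_tsum (fun k => ?_) hs
  have := cf_sub hf (ap_cont N f) k
  rw [this]
  exact cf_ap_le N f k

/-- Dirichlet kernel -/
def dk {d : ℕ} (S : Finset (Fin d → ℤ)) (z : Td d) : ℂ := ∑ a ∈ S, eK a z

lemma dk_cont {d : ℕ} (S : Finset (Fin d → ℤ)) : Continuous (dk S) :=
  continuous_finsetSum _ fun _ _ => eK_cont _

lemma int_dk {d : ℕ} (S : Finset (Fin d → ℤ)) (x : Td d) :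
    ∫ y in box d, ‖dk S (x - y)‖ ^ 2 = S.card := by
  have h : ∀ y, ((‖dk S (x - y)‖ ^ 2 : ℝ) : ℂ) =
      ∑ a ∈ S, ∑ b ∈ S, eK (a - b) x * eK (b - a) y := by
    intro y
    push_cast
    rw [← Complex.mul_conj']
    simp only [dk, map_sum, Finset.sum_mul_sum, eK_conj, ← eK_add]
    apply Finset.sum_congr rfl; intro a _
    apply Finset.sum_congr rfl; intro b _
    rw [← sub_eq_add_neg, eK_sub_arg, neg_sub]
  have : ((∫ y in box d, ‖dk S (x - y)‖ ^ 2 : ℝ) : ℂ) = S.card := by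
    rw [← integral_complex_ofReal]
    simp only [h]
    rw [integral_finsetSum]
    · have : ∀ a ∈ S, ∫ y in box d, ∑ b ∈ S, eK (a - b) x * eK (b - a) y = 1 := by
        intro a ha
        rw [integral_finsetSum]
        · simp only [integral_const_mul, int_eK, sub_eq_zero]
          simp [ha, eK_zero]
        · intro b _
          exact cont_int ((eK_cont _).const_mul _)
      rw [Finset.sum_congr rfl this]
      simp
    · intro a _
      exact cont_int (continuous_finsetSum _ fun b _ => (eK_cont _).const_mul _)
  exact_mod_cast this

lemma ap_sup {d : ℕ} (N : ℕ) {f : Td d → ℂ} (hf : Continuous f) {F : ℝ} (hF : ∀ x, ‖f x‖ ≤ F)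
    (x : Td d) : ‖ap N f x‖ ≤ 2 ^ d * F := by
  have hF0 : 0 ≤ F := (norm_nonneg _).trans (hF 0)
  set T := cube d N
  set S := cube d (2 * N)
  have h0 : (0:ℝ) < T.card := by simp only [T, card_cube]; positivity
  have e1 : ap N f x =
      (T.card : ℂ)⁻¹ * ∫ y in box d, f y * (dk S (x - y) * (starRingEnd ℂ) (dk T (x - y))) := by
    have : ∀ y, f y * (dk S (x - y) * (starRingEnd ℂ) (dk T (x - y))) =
        ∑ p ∈ T ×ˢ S, (f y * eK (-(p.2 - p.1)) y) * eK (p.2 - p.1) x := by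
      intro y
      simp only [dk, map_sum, eK_conj]
      rw [mul_comm (∑ a ∈ S, _), Finset.sum_mul_sum, ← Finset.sum_product', Finset.mul_sum]
      apply Finset.sum_congr rfl
      intro p _
      rw [← eK_add, neg_add_eq_sub, eK_sub_arg]
      ring
    simp only [this]
    rw [integral_finsetSum]
    · simp only [integral_mul_const]
      rw [ap, Finset.mul_sum]
      apply Finset.sum_congr rfl
      intro p _
      rw [mul_assoc]; rfl
    · intro p _
      exact cont_int ((hf.mul (eK_cont _)).mul_const _)
  have c1 : Continuous fun y => ‖dk S (x - y)‖ ^ 2 :=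
    (((dk_cont S).comp (continuous_const.sub continuous_id)).norm).pow 2
  have c2 : Continuous fun y => ‖dk T (x - y)‖ ^ 2 :=
    (((dk_cont T).comp (continuous_const.sub continuous_id)).norm).pow 2
  have e2 : ‖∫ y in box d, f y * (dk S (x - y) * (starRingEnd ℂ) (dk T (x - y)))‖ ≤
      ∫ y in box d, F / 2 * (‖dk S (x - y)‖ ^ 2 + ‖dk T (x - y)‖ ^ 2) := by
    apply norm_integral_le_of_norm_le
      (g := fun y => F / 2 * (‖dk S (x - y)‖ ^ 2 + ‖dk T (x - y)‖ ^ 2))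
      (cont_int ((c1.add c2).const_mul _))
    refine Filter.Eventually.of_forall fun y => ?_
    rw [norm_mul, norm_mul, RCLike.norm_conj]
    calc _ ≤ F * (‖dk S (x - y)‖ * ‖dk T (x - y)‖) := by gcongr; exact hF y
      _ ≤ F * ((‖dk S (x - y)‖ ^ 2 + ‖dk T (x - y)‖ ^ 2) / 2) := by
        gcongr
        nlinarith [sq_nonneg (‖dk S (x - y)‖ - ‖dk T (x - y)‖)]
      _ = _ := by ring
  rw [integral_const_mul, integral_add (cont_int c1) (cont_int c2), int_dk, int_dk] at e2
  have hST : (S.card : ℝ) ≤ 2 ^ d * T.card := by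
    simp only [S, T, card_cube]
    push_cast
    rw [← mul_pow]
    gcongr
    linarith
  have h2 : (1:ℝ) ≤ 2 ^ d := one_le_pow₀ (by norm_num)
  rw [e1, norm_mul, norm_inv, Complex.norm_natCast, inv_mul_le_iff₀ h0]
  refine e2.trans ?_
  have : (S.card : ℝ) + T.card ≤ 2 * (2 ^ d * T.card) := by nlinarith
  calc F / 2 * ((S.card : ℝ) + T.card) ≤ F / 2 * (2 * (2 ^ d * T.card)) := by gcongr
    _ = _ := by ring

lemma cf_ap_mul {d : ℕ} (N : ℕ) (f g : Td d → ℂ) (k : Fin d → ℤ) (hk : 6 * N < nrm k) :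
    cf (fun x => ap N f x * ap N g x) k = 0 := by
  unfold ap
  have : ∀ x : Td d, (∑ p ∈ cube d N ×ˢ cube d (2 * N),
      (((cube d N).card : ℂ)⁻¹ * cf f (p.2 - p.1)) * eK (p.2 - p.1) x) *
      (∑ p ∈ cube d N ×ˢ cube d (2 * N),
      (((cube d N).card : ℂ)⁻¹ * cf g (p.2 - p.1)) * eK (p.2 - p.1) x) =
      ∑ q ∈ (cube d N ×ˢ cube d (2 * N)) ×ˢ (cube d N ×ˢ cube d (2 * N)),
      ((((cube d N).card : ℂ)⁻¹ * cf f (q.1.2 - q.1.1)) *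
      (((cube d N).card : ℂ)⁻¹ * cf g (q.2.2 - q.2.1))) *
        eK ((q.1.2 - q.1.1) + (q.2.2 - q.2.1)) x := by
    intro x
    rw [Finset.sum_mul_sum, ← Finset.sum_product']
    apply Finset.sum_congr rfl
    intro q _
    rw [eK_add]; ring
  simp only [this]
  rw [cf_trig]
  apply Finset.sum_eq_zero
  intro q hq
  simp only [Finset.mem_product, mem_cube] at hq
  rw [if_neg]
  intro h
  have h1 := nrm_add (q.1.2 - q.1.1) (q.2.2 - q.2.1)
  have h2 := nrm_sub q.1.2 q.1.1
  have h3 := nrm_sub q.2.2 q.2.1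
  rw [h] at h1
  omega
lemma core {d : ℕ} (N : ℕ) {f g : Td d → ℂ} (hf : Continuous f) (hg : Continuous g) {F G : ℝ}
    (hF : ∀ x, ‖f x‖ ≤ F) (hG : ∀ x, ‖g x‖ ≤ G) (A : Finset (Fin d → ℤ)) :
    ∑ k ∈ A, (if 6 * N < nrm k then ‖cf (fun x => f x * g x) k‖ ^ 2 else 0) ≤
      2 * (G ^ 2 * (∑' k, if N < nrm k then ‖cf f k‖ ^ 2 else 0) +
        (2 ^ d * F) ^ 2 * (∑' k, if N < nrm k then ‖cf g k‖ ^ 2 else 0)) := by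
  have cp := ap_cont N f
  have cq := ap_cont N g
  have hG0 : 0 ≤ G := (norm_nonneg _).trans (hG 0)
  have hh : Continuous fun x => f x * g x - ap N f x * ap N g x := (hf.mul hg).sub (cp.mul cq)
  have P := parseval hh
  have s1 : ∑ k ∈ A, (if 6 * N < nrm k then ‖cf (fun x => f x * g x) k‖ ^ 2 else 0) ≤
      ∫ x in box d, ‖f x * g x - ap N f x * ap N g x‖ ^ 2 := by
    refine le_trans (Finset.sum_le_sum fun k _ => ?_)
      (sum_le_hasSum A (fun _ _ => by positivity) P)
    split_ifs with h
    · rw [cf_sub (f := fun x => f x * g x) (g := fun x => ap N f x * ap N g x) (hf.mul hg)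
        (cp.mul cq), cf_ap_mul N f g k h, sub_zero]
    · positivity
  have c1 : Continuous fun x => ‖f x - ap N f x‖ ^ 2 := (hf.sub cp).norm.pow 2
  have c2 : Continuous fun x => ‖g x - ap N g x‖ ^ 2 := (hg.sub cq).norm.pow 2
  have s2 : ∫ x in box d, ‖f x * g x - ap N f x * ap N g x‖ ^ 2 ≤
      ∫ x in box d, 2 * (G ^ 2 * ‖f x - ap N f x‖ ^ 2 +
        (2 ^ d * F) ^ 2 * ‖g x - ap N g x‖ ^ 2) := by
    refine integral_mono (cont_int (by fun_prop)) (cont_int (by fun_prop)) fun x => ?_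
    dsimp only
    have e : f x * g x - ap N f x * ap N g x =
      (f x - ap N f x) * g x + ap N f x * (g x - ap N g x) := by ring
    have b1 : ‖f x * g x - ap N f x * ap N g x‖ ≤
        G * ‖f x - ap N f x‖ + (2 ^ d * F) * ‖g x - ap N g x‖ := by
      rw [e]
      refine (norm_add_le _ _).trans ?_
      rw [norm_mul, norm_mul, mul_comm]
      gcongr
      · exact hG x
      · exact ap_sup N hf hF x
    calc _ ≤ (G * ‖f x - ap N f x‖ + (2 ^ d * F) * ‖g x - ap N g x‖) ^ 2 := by gcongr
      _ ≤ _ := by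
        nlinarith [sq_nonneg (G * ‖f x - ap N f x‖ - (2 ^ d * F) * ‖g x - ap N g x‖)]
  rw [integral_const_mul, integral_add (cont_int (c1.const_mul _)) (cont_int (c2.const_mul _)),
    integral_const_mul, integral_const_mul] at s2
  refine s1.trans (s2.trans ?_)
  gcongr
  · exact ap_l2 N hf
  · exact ap_l2 N hg

/-- radial weight -/
def ww (s : ℝ) (n : ℕ) : ℝ := (1 + (n : ℝ) ^ 2) ^ s

lemma ww_mono {s : ℝ} (hs : 0 ≤ s) {m n : ℕ} (h : m ≤ n) : ww s m ≤ ww s n := by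
  unfold ww
  gcongr

lemma ww_zero (s : ℝ) : ww s 0 = 1 := by simp [ww]

lemma nrm_sq_le {d : ℕ} (k : Fin d → ℤ) : ((nrm k : ℕ) : ℝ) ^ 2 ≤ ∑ i, ((k i : ℝ)) ^ 2 := by
  rcases Nat.eq_zero_or_pos d with rfl | hd
  · simp [nrm]
  · have : Nonempty (Fin d) := ⟨⟨0, hd⟩⟩
    obtain ⟨i, _, hi⟩ := Finset.exists_mem_eq_sup Finset.univ Finset.univ_nonempty
      (fun i => (k i).natAbs)
    have : nrm k = (k i).natAbs := hi
    rw [this, Nat.cast_natAbs, Int.cast_abs, sq_abs]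
    exact Finset.single_le_sum (f := fun i => ((k i : ℝ)) ^ 2) (fun _ _ => by positivity)
      (Finset.mem_univ i)

lemma le_nrm_sq {d : ℕ} (k : Fin d → ℤ) : ∑ i, ((k i : ℝ)) ^ 2 ≤ d * ((nrm k : ℕ) : ℝ) ^ 2 := by
  refine (Finset.sum_le_card_nsmul _ _ (((nrm k : ℕ) : ℝ) ^ 2) ?_).trans (by simp)
  intro i _
  have := (nrm_le (k := k)).1 le_rfl i
  rw [← sq_abs, ← Int.cast_abs, ← Nat.cast_natAbs]
  gcongr

lemma ww_le_wt {d : ℕ} {s : ℝ} (hs : 0 ≤ s) (k : Fin d → ℤ) : ww s (nrm k) ≤ wt s k := by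
  unfold ww wt
  have := nrm_sq_le k
  gcongr

lemma wt_le {d : ℕ} {s : ℝ} (hs : 0 ≤ s) (k : Fin d → ℤ) :
    wt s k ≤ (36 * (1 + d)) ^ s * ww s ((nrm k + 5) / 6) := by
  unfold ww wt
  have h1 := le_nrm_sq k
  have h2 : nrm k ≤ 6 * ((nrm k + 5) / 6) := by omega
  set q := (nrm k + 5) / 6
  have h3 : ((nrm k : ℕ) : ℝ) ≤ 6 * (q : ℝ) := by exact_mod_cast h2
  rw [← Real.mul_rpow (by positivity) (by positivity)]
  apply Real.rpow_le_rpow (by positivity) _ hs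
  have h4 : ((nrm k : ℕ) : ℝ) ^ 2 ≤ 36 * (q : ℝ) ^ 2 := by
    have : ((nrm k : ℕ) : ℝ) ^ 2 ≤ (6 * (q : ℝ)) ^ 2 := by gcongr
    linarith
  have h5 : (d : ℝ) * ((nrm k : ℕ) : ℝ) ^ 2 ≤ d * (36 * (q : ℝ) ^ 2) := by gcongr
  have h6 : (0:ℝ) ≤ d := by positivity
  nlinarith [sq_nonneg (q : ℝ)]

lemma swap {d : ℕ} {s : ℝ} (hs : 0 ≤ s) (u : (Fin d → ℤ) → ℝ) (hu : ∀ k, 0 ≤ u k)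
    (hsum : Summable fun k => wt s k * u k) (R : ℕ) :
    ∑ N ∈ Finset.range R, (ww s (N + 1) - ww s N) * (∑' k, if N < nrm k then u k else 0) ≤
      ∑' k, wt s k * u k := by
  have ha : ∀ N, 0 ≤ ww s (N + 1) - ww s N := fun N => sub_nonneg.2 (ww_mono hs (Nat.le_succ N))
  have hw1 : ∀ k : Fin d → ℤ, 1 ≤ wt s k := fun k => by
    rw [← ww_zero s]; exact (ww_mono hs (Nat.zero_le _)).trans (ww_le_wt hs k)
  have hsN : ∀ N, Summable fun k => if N < nrm k then u k else 0 := by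
    intro N
    refine Summable.of_nonneg_of_le ?_ ?_ hsum
    · intro k; split_ifs
      · exact hu k
      · exact le_rfl
    · intro k
      have := le_mul_of_one_le_left (hu k) (hw1 k)
      split_ifs
      · exact this
      · exact (hu k).trans this
  simp only [← tsum_mul_left]
  rw [← Summable.tsum_finsetSum (fun N _ => (hsN N).mul_left _)]
  refine Summable.tsum_le_tsum ?_ (summable_sum fun N _ => (hsN N).mul_left _) hsum
  intro k
  have h1 : ∑ N ∈ Finset.range R, (ww s (N + 1) - ww s N) * (if N < nrm k then u k else 0) ≤
      ∑ N ∈ Finset.range (nrm k), (ww s (N + 1) - ww s N) * u k := by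
    simp only [mul_ite, mul_zero]
    rw [← Finset.sum_filter]
    apply Finset.sum_le_sum_of_subset_of_nonneg
    · intro N hN
      simp only [Finset.mem_filter] at hN
      exact Finset.mem_range.2 hN.2
    · intro N _ _
      exact mul_nonneg (ha N) (hu k)
  refine h1.trans ?_
  rw [← Finset.sum_mul, Finset.sum_range_sub]
  have := ww_le_wt hs k
  have h0 := ww_zero s
  exact mul_le_mul_of_nonneg_right (by linarith) (hu k)

lemma l2_le {d : ℕ} {s : ℝ} (hs : 0 ≤ s) {f g : Td d → ℂ} (hf : Continuous f) (hg : Continuous g)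
    {F : ℝ} (hF : ∀ x, ‖f x‖ ≤ F) (hsum : Summable fun k => wt s k * ‖cf g k‖ ^ 2)
    (A : Finset (Fin d → ℤ)) :
    ∑ k ∈ A, ‖cf (fun x => f x * g x) k‖ ^ 2 ≤ F ^ 2 * ∑' k, wt s k * ‖cf g k‖ ^ 2 := by
  have hF0 : 0 ≤ F := (norm_nonneg _).trans (hF 0)
  have hw1 : ∀ k : Fin d → ℤ, 1 ≤ wt s k := fun k => by
    rw [← ww_zero s]; exact (ww_mono hs (Nat.zero_le _)).trans (ww_le_wt hs k)
  refine (sum_le_hasSum A (fun _ _ => by positivity) (parseval (hf.mul hg))).trans ?_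
  have h1 : ∫ x in box d, ‖f x * g x‖ ^ 2 ≤ ∫ x in box d, F ^ 2 * ‖g x‖ ^ 2 := by
    refine integral_mono (cont_int (by fun_prop)) (cont_int (by fun_prop)) fun x => ?_
    dsimp only
    rw [norm_mul, mul_pow]
    gcongr
    exact hF x
  refine h1.trans ?_
  rw [integral_const_mul, ← (parseval hg).tsum_eq]
  refine mul_le_mul_of_nonneg_left ?_ (by positivity)
  refine Summable.tsum_le_tsum (fun k => ?_) (parseval hg).summable hsum
  exact le_mul_of_one_le_left (by positivity) (hw1 k)

lemma main_est {d : ℕ} {s : ℝ} (hs : 0 ≤ s) {f g : Td d → ℂ} (hf : Continuous f)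
    (hg : Continuous g) {F G : ℝ} (hF : ∀ x, ‖f x‖ ≤ F) (hG : ∀ x, ‖g x‖ ≤ G)
    (sf : Summable fun k => wt s k * ‖cf f k‖ ^ 2) (sg : Summable fun k => wt s k * ‖cf g k‖ ^ 2)
    (A : Finset (Fin d → ℤ)) :
    ∑ k ∈ A, wt s k * ‖cf (fun x => f x * g x) k‖ ^ 2 ≤
      (36 * (1 + d)) ^ s * (F ^ 2 * (∑' k, wt s k * ‖cf g k‖ ^ 2) +
        2 * (G ^ 2 * (∑' k, wt s k * ‖cf f k‖ ^ 2) +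
        (2 ^ d * F) ^ 2 * (∑' k, wt s k * ‖cf g k‖ ^ 2))) := by
  set H := fun k => ‖cf (fun x => f x * g x) k‖ ^ 2 with hH
  have ha : ∀ N, 0 ≤ ww s (N + 1) - ww s N := fun N => sub_nonneg.2 (ww_mono hs (Nat.le_succ N))
  have hH0 : ∀ k, 0 ≤ H k := fun k => by positivity
  set R := A.sup fun k => nrm k + 5
  have h1 : ∀ k ∈ A, wt s k * H k ≤ (36 * (1 + d)) ^ s * (H k +
      ∑ N ∈ Finset.range R, (ww s (N + 1) - ww s N) * (if 6 * N < nrm k then H k else 0)) := by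
    intro k hk
    have e1 : ww s ((nrm k + 5) / 6) * H k ≤ H k +
        ∑ N ∈ Finset.range R, (ww s (N + 1) - ww s N) * (if 6 * N < nrm k then H k else 0) := by
      have e2 : ∑ N ∈ Finset.range ((nrm k + 5) / 6), (ww s (N + 1) - ww s N) * H k ≤
        ∑ N ∈ Finset.range R, (ww s (N + 1) - ww s N) * (if 6 * N < nrm k then H k else 0) := by
        simp only [mul_ite, mul_zero]
        rw [← Finset.sum_filter]
        apply Finset.sum_le_sum_of_subset_of_nonneg
        · intro N hN
          have hR : nrm k + 5 ≤ R := Finset.le_sup (f := fun k => nrm k + 5) hk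
          simp only [Finset.mem_filter, Finset.mem_range] at hN ⊢
          omega
        · intro N _ _
          exact mul_nonneg (ha N) (hH0 k)
      rw [← Finset.sum_mul, Finset.sum_range_sub, ww_zero] at e2
      linarith
    calc wt s k * H k ≤ ((36 * (1 + d)) ^ s * ww s ((nrm k + 5) / 6)) * H k :=
          mul_le_mul_of_nonneg_right (wt_le hs k) (hH0 k)
      _ = (36 * (1 + d)) ^ s * (ww s ((nrm k + 5) / 6) * H k) := by ring
      _ ≤ _ := by gcongr
  refine (Finset.sum_le_sum h1).trans ?_
  rw [← Finset.mul_sum, Finset.sum_add_distrib]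
  gcongr
  · exact l2_le hs hf hg hF sg A
  · rw [Finset.sum_comm]
    simp only [← Finset.mul_sum]
    have h2 : ∀ N ∈ Finset.range R, (ww s (N + 1) - ww s N) *
        ∑ k ∈ A, (if 6 * N < nrm k then H k else 0) ≤
        2 * (G ^ 2 * ((ww s (N + 1) - ww s N) * (∑' k, if N < nrm k then ‖cf f k‖ ^ 2 else 0)) +
        (2 ^ d * F) ^ 2 *
          ((ww s (N + 1) - ww s N) * (∑' k, if N < nrm k then ‖cf g k‖ ^ 2 else 0))) := by
      intro N _
      refine (mul_le_mul_of_nonneg_left (core N hf hg hF hG A) (ha N)).trans (le_of_eq ?_)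
      ring
    refine (Finset.sum_le_sum h2).trans ?_
    rw [← Finset.mul_sum, Finset.sum_add_distrib, ← Finset.mul_sum, ← Finset.mul_sum]
    gcongr
    · exact swap hs _ (fun k => by positivity) sf R
    · exact swap hs _ (fun k => by positivity) sg R

lemma abs_le_linf {d : ℕ} {f : Td d → ℝ} (hf : Continuous f) (hp : TPer f) (x : Td d) :
    |f x| ≤ linf f := by
  obtain ⟨C, hC⟩ := (isCompact_Icc (a := (0 : Td d)) (b := 1)).exists_bound_of_continuousOn
    hf.continuousOn
  apply le_ciSup (f := fun x => |f x|)
  refine ⟨C, ?_⟩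
  rintro _ ⟨y, rfl⟩
  have h := hp (fun i => Int.fract (y i)) (fun i => ⌊y i⌋)
  simp only [Int.fract_add_floor] at h
  dsimp only
  rw [h]
  exact hC _ ⟨fun i => Int.fract_nonneg _, fun i => (Int.fract_lt_one _).le⟩

/-- Product estimate: for `s ≥ 0` there is `C = C(s,d)` such that
`‖fg‖_{H^s} ≤ C(‖f‖_{L^∞}‖g‖_{H^s} + ‖f‖_{H^s}‖g‖_{L^∞})`. -/
theorem product_estimate (d : ℕ) (hd : 0 < d) (s : ℝ) (hs : 0 ≤ s) :
    ∃ C > 0, ∀ f g : Td d → ℝ,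
      Continuous f → TPer f → InHs s f →
      Continuous g → TPer g → InHs s g →
      hsNorm s (fun x => f x * g x)
        ≤ C * (linf f * hsNorm s g + hsNorm s f * linf g) := by
  have hK : 0 < ((36 * (1 + d)) ^ s : ℝ) := by positivity
  set K : ℝ := (36 * (1 + d)) ^ s with hKdef
  set B : ℝ := K * (3 * (2 ^ d) ^ 2) with hB
  have hBpos : 0 < B := by positivity
  refine ⟨Real.sqrt B, Real.sqrt_pos.2 hBpos, ?_⟩
  intro f g cf1 pf sf cg1 pg sg
  have hF := abs_le_linf cf1 pf
  have hG := abs_le_linf cg1 pg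
  have hF0 : 0 ≤ linf f := (abs_nonneg _).trans (hF 0)
  have hG0 : 0 ≤ linf g := (abs_nonneg _).trans (hG 0)
  have hnn : ∀ h : Td d → ℝ, 0 ≤ hsNormSq s h := fun h =>
    tsum_nonneg fun k => mul_nonneg (by unfold wt; positivity) (by positivity)
  have key : hsNormSq s (fun x => f x * g x) ≤
      K * (linf f ^ 2 * hsNormSq s g + 2 * (linf g ^ 2 * hsNormSq s f +
        (2 ^ d * linf f) ^ 2 * hsNormSq s g)) := by
    have hb := main_est (d := d) hs (f := fun x => (f x : ℂ)) (g := fun x => (g x : ℂ))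
      (by fun_prop) (by fun_prop) (F := linf f) (G := linf g)
      (fun x => by simpa using hF x) (fun x => by simpa using hG x)
      (by simpa only [InHs, fCoeff_eq_cf] using sf) (by simpa only [InHs, fCoeff_eq_cf] using sg)
    have e : hsNormSq s (fun x => f x * g x) =
        ∑' k, wt s k * ‖cf (fun x => (f x : ℂ) * (g x : ℂ)) k‖ ^ 2 := by
      simp only [hsNormSq, fCoeff_eq_cf, Complex.ofReal_mul]
    rw [e]
    simp only [hsNormSq, fCoeff_eq_cf]
    exact Real.tsum_le_of_sum_le
      (fun k => mul_nonneg (by unfold wt; positivity) (by positivity)) hb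
  have hf2 : hsNorm s f ^ 2 = hsNormSq s f := Real.sq_sqrt (hnn f)
  have hg2 : hsNorm s g ^ 2 = hsNormSq s g := Real.sq_sqrt (hnn g)
  have hf0 : 0 ≤ hsNorm s f := Real.sqrt_nonneg _
  have hg0 : 0 ≤ hsNorm s g := Real.sqrt_nonneg _
  rw [← hf2, ← hg2] at key
  generalize hsNorm s f = a at *
  generalize hsNorm s g = b at *
  have hP : (1:ℝ) ≤ (2 ^ d) ^ 2 := one_le_pow₀ (one_le_pow₀ (by norm_num))
  unfold hsNorm
  have hfin : hsNormSq s (fun x => f x * g x) ≤ B * (linf f * b + a * linf g) ^ 2 := by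
    refine key.trans ?_
    rw [hB, mul_assoc]
    apply mul_le_mul_of_nonneg_left _ hK.le
    have e1 : 0 ≤ (linf f * b) * (a * linf g) := by positivity
    have e2 : 0 ≤ (linf f * b) ^ 2 := by positivity
    have e3 : 0 ≤ (a * linf g) ^ 2 := by positivity
    have q1 := mul_nonneg (sub_nonneg.2 hP) e2
    have q2 := mul_nonneg (sub_nonneg.2 hP) e3
    have q3 := mul_nonneg (zero_le_one.trans hP) e1
    nlinarith
  rw [← Real.sqrt_sq (show 0 ≤ linf f * b + a * linf g by positivity), ← Real.sqrt_mul hBpos.le]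
  exact Real.sqrt_le_sqrt hfin
end
end

section
/- Let s ≥ 0 and 0 < σ ≤ d/2. There is a constant C such that for all f ∈ H^s ∩ H^{d/2-σ}(T^d) and g ∈ L^∞ ∩ H^{s+σ}(T^d), ‖fg‖_{H^s} ≤ C(‖f‖_{H^s}‖g‖_{L^∞} + ‖f‖_{H^{d/2-σ}}‖g‖_{H^{s+σ}}). -/
open MeasureTheory Complex Real

noncomputable section

open scoped ENNReal

def Nn {d : ℕ} (k : Fin d → ℤ) : ℕ := 1 + ∑ i, (k i).natAbs ^ 2

lemma Nn_pos {d : ℕ} (k : Fin d → ℤ) : 0 < Nn k := by unfold Nn; omega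

lemma Nn_ne {d : ℕ} (k : Fin d → ℤ) : (Nn k : ℝ≥0∞) ≠ 0 := by
  exact_mod_cast (Nn_pos k).ne'

lemma Nn_tri {d : ℕ} (k l : Fin d → ℤ) : Nn k ≤ 2 * Nn l + 2 * Nn (k - l) := by
  have h : ∑ i, (k i).natAbs ^ 2 ≤ 2 * ∑ i, (l i).natAbs ^ 2 + 2 * ∑ i, ((k - l) i).natAbs ^ 2 := by
    rw [Finset.mul_sum, Finset.mul_sum, ← Finset.sum_add_distrib]
    refine Finset.sum_le_sum fun i _ => ?_
    zify
    simp only [sq_abs, Pi.sub_apply]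
    nlinarith [sq_nonneg (2 * l i - k i)]
  unfold Nn
  omega

lemma wt_eq {d : ℕ} (t : ℝ) (k : Fin d → ℤ) : ENNReal.ofReal (wt t k) = (Nn k : ℝ≥0∞) ^ t := by
  have h : (1 + ∑ i, ((k i : ℝ))^2) = (Nn k : ℝ) := by
    unfold Nn
    push_cast
    congr 1
    refine Finset.sum_congr rfl fun i _ => ?_
    rw [Nat.cast_natAbs]
    simp
  unfold wt
  rw [h, ← ENNReal.ofReal_rpow_of_pos (by exact_mod_cast Nn_pos k)]
  simp

lemma geo (t : ℝ) (ht : 0 < t) : ∃ K : ℝ≥0∞, K ≠ ⊤ ∧ ∀ X : ℕ,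
    ∑' j : ℕ, (if 4 ^ j ≤ X then ((4:ℝ≥0∞) ^ j) ^ t else 0) ≤ K * (X : ℝ≥0∞) ^ t := by
  set r : ℝ≥0∞ := (4:ℝ≥0∞) ^ t with hr
  have hr1 : 1 < r := ENNReal.one_lt_rpow (by norm_num) ht
  have hrt : r ≠ ⊤ := ENNReal.rpow_ne_top_of_nonneg ht.le (by norm_num)
  have hr0 : r ≠ 0 := (zero_lt_one.trans hr1).ne'
  have hpow : ∀ j : ℕ, ((4:ℝ≥0∞) ^ j) ^ t = r ^ j := by
    intro j
    rw [hr, ← ENNReal.rpow_natCast, ← ENNReal.rpow_natCast, ← ENNReal.rpow_mul, ← ENNReal.rpow_mul,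
      mul_comm]
  refine ⟨(1 - r⁻¹)⁻¹, ?_, fun X => ?_⟩
  · rw [ENNReal.inv_ne_top]
    exact (tsub_pos_of_lt (ENNReal.inv_lt_one.2 hr1)).ne'
  rcases Nat.eq_zero_or_pos X with rfl | hX
  · simp
  set J := Nat.log 4 X
  have hJ : ∀ j, 4 ^ j ≤ X ↔ j ≤ J := fun j => (Nat.le_log_iff_pow_le (by norm_num) hX.ne').symm
  have h1 : ∑' j : ℕ, (if 4 ^ j ≤ X then ((4:ℝ≥0∞) ^ j) ^ t else 0) = ∑ j ∈ Finset.range (J+1), r ^ j := by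
    rw [tsum_eq_sum (s := Finset.range (J+1))]
    · refine Finset.sum_congr rfl fun j hj => ?_
      rw [if_pos ((hJ j).2 (by simpa [Nat.lt_succ_iff] using hj)), hpow]
    · intro j hj
      rw [if_neg]
      rw [hJ]
      simpa [Nat.lt_succ_iff] using hj
  rw [h1, ← Finset.sum_range_reflect]
  have h2 : ∀ j ∈ Finset.range (J+1), r ^ (J + 1 - 1 - j) = r ^ J * r⁻¹ ^ j := by
    intro j hj
    have hj' : j ≤ J := by simpa [Nat.lt_succ_iff] using hj
    obtain ⟨m, hm⟩ := Nat.exists_eq_add_of_le hj'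
    rw [hm, show j + m + 1 - 1 - j = m by omega, pow_add, ← ENNReal.inv_pow, mul_comm, ← mul_assoc,
      ENNReal.inv_mul_cancel (pow_ne_zero _ hr0) (ENNReal.pow_ne_top hrt), one_mul]
  rw [Finset.sum_congr rfl h2, ← Finset.mul_sum, mul_comm]
  refine mul_le_mul' ?_ ?_
  · rw [← ENNReal.tsum_geometric]
    exact ENNReal.sum_le_tsum _
  · rw [← hpow]
    refine ENNReal.rpow_le_rpow ?_ ht.le
    exact_mod_cast (hJ J).2 le_rfl

lemma Nn_abs {d : ℕ} (k : Fin d → ℤ) (i : Fin d) : (k i).natAbs ^ 2 < Nn k := by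
  have := Finset.single_le_sum (f := fun i => (k i).natAbs ^ 2) (fun _ _ => Nat.zero_le _)
    (Finset.mem_univ i)
  unfold Nn
  omega

lemma Nn_box {d : ℕ} (k : Fin d → ℤ) (j : ℕ) (h : Nn k ≤ 4 ^ j) :
    k ∈ Fintype.piFinset (fun _ : Fin d => Finset.Icc (-(2:ℤ)^j) (2^j)) := by
  rw [Fintype.mem_piFinset]
  intro i
  have h1 := (Nn_abs k i).trans_le h
  rw [show (4:ℕ) = 2 ^ 2 by norm_num, ← pow_mul, mul_comm, pow_mul] at h1
  have h2 : (k i).natAbs < 2 ^ j := lt_of_pow_lt_pow_left₀ 2 (by positivity) h1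
  have h3 : |k i| < 2 ^ j := by zify at h2; exact h2
  rw [abs_lt] at h3
  simp only [Finset.mem_Icc]
  constructor <;> linarith

lemma count {d : ℕ} (i : ℕ) :
    ∑' l : Fin d → ℤ, (if Nn l ≤ 4 ^ (i+1) then (1:ℝ≥0∞) else 0) ≤ 8 ^ d * ((4:ℝ≥0∞) ^ i) ^ ((d:ℝ)/2) := by
  rw [tsum_eq_sum (s := Fintype.piFinset (fun _ : Fin d => Finset.Icc (-(2:ℤ)^(i+1)) (2^(i+1))))]
  swap
  · intro l hl
    rw [if_neg]
    exact fun h => hl (Nn_box l _ h)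
  calc _ ≤ ∑ l ∈ Fintype.piFinset (fun _ : Fin d => Finset.Icc (-(2:ℤ)^(i+1)) (2^(i+1))), (1:ℝ≥0∞) := by
        refine Finset.sum_le_sum fun l _ => ?_
        split_ifs <;> simp
    _ = (((2:ℤ)^(i+1) + 1 + 2^(i+1)).toNat : ℝ≥0∞) ^ d := by
        simp [Fintype.card_piFinset]
    _ ≤ ((8 * 2 ^ i : ℕ) : ℝ≥0∞) ^ d := by
        gcongr
        rw [Int.toNat_le]
        have : (1:ℤ) ≤ 2 ^ i := one_le_pow₀ (by norm_num)
        push_cast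
        rw [pow_succ]
        linarith
    _ = 8 ^ d * ((4:ℝ≥0∞) ^ i) ^ ((d:ℝ)/2) := by
        push_cast
        rw [mul_pow]
        congr 1
        rw [show (4:ℝ≥0∞) = 2 ^ (2:ℝ) by norm_num, ← ENNReal.rpow_natCast, ← ENNReal.rpow_natCast,
          ← ENNReal.rpow_natCast, ← ENNReal.rpow_mul, ← ENNReal.rpow_mul, ← ENNReal.rpow_mul]
        congr 1
        ring

/-- dyadic decomposition -/
lemma dyad {d : ℕ} (F : (Fin d → ℤ) → ℝ≥0∞) :
    ∑' k, F k = ∑' j : ℕ, ∑' k, if Nat.log 4 (Nn k) = j then F k else 0 := by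
  rw [ENNReal.tsum_comm]
  refine tsum_congr fun k => ?_
  simp

lemma lattice (d : ℕ) (σ : ℝ) (hσ : 0 < σ) (hσd : σ ≤ (d : ℝ)/2) :
    ∃ K : ℝ≥0∞, K ≠ ⊤ ∧ ∀ j : ℕ,
    ∑' l : Fin d → ℤ, (if Nn l ≤ 4 ^ j then (Nn l : ℝ≥0∞) ^ (-((d:ℝ)/2 - σ)) else 0)
      ≤ K * ((4:ℝ≥0∞) ^ j) ^ σ := by
  obtain ⟨K, hK, h⟩ := geo σ hσ
  refine ⟨8 ^ d * K, ENNReal.mul_ne_top (by simp) hK, fun j => ?_⟩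
  rw [dyad]
  calc _ ≤ ∑' i : ℕ, 8 ^ d * (if 4 ^ i ≤ 4 ^ j then ((4:ℝ≥0∞) ^ i) ^ σ else 0) := by
        refine ENNReal.tsum_le_tsum fun i => ?_
        by_cases hij : 4 ^ i ≤ 4 ^ j
        · rw [if_pos hij]
          calc _ ≤ ∑' l : Fin d → ℤ, ((4:ℝ≥0∞) ^ i) ^ (-((d:ℝ)/2 - σ)) *
                    (if Nn l ≤ 4 ^ (i+1) then (1:ℝ≥0∞) else 0) := by
                refine ENNReal.tsum_le_tsum fun l => ?_
                split_ifs with h1 h2 h3 h4 <;> try simp [-neg_sub]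
                · rw [ENNReal.rpow_neg, ENNReal.rpow_neg, ENNReal.inv_le_inv]
                  refine ENNReal.rpow_le_rpow ?_ (by linarith)
                  rw [← h1]
                  exact_mod_cast Nat.pow_log_le_self 4 (Nn_pos l).ne'
                · exfalso
                  apply h3
                  rw [← h1]
                  exact (Nat.lt_pow_succ_log_self (by norm_num) _).le
            _ ≤ ((4:ℝ≥0∞) ^ i) ^ (-((d:ℝ)/2 - σ)) * (8 ^ d * ((4:ℝ≥0∞) ^ i) ^ ((d:ℝ)/2)) := by
                rw [ENNReal.tsum_mul_left]
                gcongr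
                exact count i
            _ = _ := by
                rw [mul_left_comm, ← ENNReal.rpow_add _ _ (by simp) (by simp)]
                congr 2
                ring
        · rw [if_neg hij]
          simp only [mul_zero, nonpos_iff_eq_zero, ENNReal.tsum_eq_zero]
          intro l
          split_ifs with h1 h2
          · exfalso
            apply hij
            rw [← h1]
            exact (Nat.pow_log_le_self 4 (Nn_pos l).ne').trans h2
          · rfl
          · rfl
    _ ≤ 8 ^ d * (K * ((4:ℝ≥0∞) ^ j) ^ σ) := by
        rw [ENNReal.tsum_mul_left]
        gcongr
        simpa using h (4 ^ j)
    _ = _ := by rw [mul_assoc]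

lemma cs {ι : Type*} (S : Finset ι) (p u v : ι → ℝ≥0∞) (h : ∀ i, p i ^ 2 ≤ u i * v i) :
    (∑ i ∈ S, p i) ^ 2 ≤ (∑ i ∈ S, u i) * ∑ i ∈ S, v i := by
  have h1 : ∀ i, p i ≤ u i ^ (1/2:ℝ) * v i ^ (1/2:ℝ) := by
    intro i
    rw [← ENNReal.mul_rpow_of_nonneg _ _ (by norm_num)]
    rw [one_div, ENNReal.le_rpow_inv_iff (by norm_num)]
    simpa using h i
  have h2 := (Finset.sum_le_sum fun i (_ : i ∈ S) => h1 i).trans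
    (ENNReal.inner_le_Lp_mul_Lq S (fun i => u i ^ (1/2:ℝ)) (fun i => v i ^ (1/2:ℝ))
      (p := 2) (q := 2) ⟨by norm_num, by norm_num, by norm_num⟩)
  simp only [← ENNReal.rpow_mul] at h2
  norm_num at h2
  calc _ ≤ _ := pow_le_pow_left' h2 2
    _ = _ := by
      rw [mul_pow, ← ENNReal.rpow_natCast, ← ENNReal.rpow_natCast, ← ENNReal.rpow_mul, ← ENNReal.rpow_mul]
      norm_num

lemma abstract_est (d : ℕ) (s σ : ℝ) (hs : 0 < s) (hσ : 0 < σ) (hσd : σ ≤ (d : ℝ)/2) :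
    ∃ K₁ K₂ : ℝ≥0∞, K₁ ≠ ⊤ ∧ K₂ ≠ ⊤ ∧ ∀ (a b c : (Fin d → ℤ) → ℝ≥0∞) (M : ℝ≥0∞),
      (∀ S : Finset (Fin d → ℤ), ∃ u v : (Fin d → ℤ) → ℝ≥0∞,
        (∀ k, c k ≤ u k + v k) ∧
        (∑' k, u k ^ 2 ≤ M ^ 2 * ∑' l, if l ∈ S then 0 else a l ^ 2) ∧
        (∀ k, v k ≤ ∑ l ∈ S, a l * b (k - l))) →
      ∑' k, (Nn k : ℝ≥0∞) ^ s * c k ^ 2 ≤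
        K₁ * (M ^ 2 * ∑' k, (Nn k : ℝ≥0∞) ^ s * a k ^ 2) +
        K₂ * ((∑' k, (Nn k : ℝ≥0∞) ^ ((d:ℝ)/2 - σ) * a k ^ 2) *
          ∑' k, (Nn k : ℝ≥0∞) ^ (s + σ) * b k ^ 2) := by
  obtain ⟨Ka, hKa, ha⟩ := geo s hs
  obtain ⟨Kb, hKb, hb⟩ := geo (s + σ) (by linarith)
  obtain ⟨Kl, hKl, hl⟩ := lattice d σ hσ hσd
  have h4 : ∀ t : ℝ, 0 ≤ t → (4:ℝ≥0∞) ^ t ≠ ⊤ := fun t ht =>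
    ENNReal.rpow_ne_top_of_nonneg ht (by norm_num)
  refine ⟨(4:ℝ≥0∞) ^ s * 2 * (Ka * (4:ℝ≥0∞) ^ s),
    (4:ℝ≥0∞) ^ s * 2 * Kl * (Kb * (4:ℝ≥0∞) ^ (s+σ)), ?_, ?_, ?_⟩
  · have := h4 s hs.le
    finiteness
  · have := h4 s hs.le
    have := h4 (s+σ) (by linarith)
    finiteness
  intro a b c M H
  set Ef := ∑' k, (Nn k : ℝ≥0∞) ^ ((d:ℝ)/2 - σ) * a k ^ 2 with hEf
  -- tail sums
  have tail : ∀ (t : ℝ) (K : ℝ≥0∞), 0 < t → (∀ X : ℕ,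
      ∑' j : ℕ, (if 4 ^ j ≤ X then ((4:ℝ≥0∞) ^ j) ^ t else 0) ≤ K * (X : ℝ≥0∞) ^ t) →
      ∀ e : (Fin d → ℤ) → ℝ≥0∞,
      ∑' j : ℕ, ((4:ℝ≥0∞) ^ j) ^ t * ∑' m, (if 4 ^ j ≤ 4 * Nn m then e m ^ 2 else 0) ≤
        (K * (4:ℝ≥0∞) ^ t) * ∑' m, (Nn m : ℝ≥0∞) ^ t * e m ^ 2 := by
    intro t K ht hK e
    simp_rw [← ENNReal.tsum_mul_left]
    rw [ENNReal.tsum_comm]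
    refine ENNReal.tsum_le_tsum fun m => ?_
    calc _ = ∑' j : ℕ, (if 4 ^ j ≤ 4 * Nn m then ((4:ℝ≥0∞) ^ j) ^ t else 0) * e m ^ 2 := by
          refine tsum_congr fun j => ?_
          split_ifs <;> simp
      _ ≤ (K * ((4 * Nn m : ℕ) : ℝ≥0∞) ^ t) * e m ^ 2 := by
          rw [ENNReal.tsum_mul_right]
          gcongr
          exact hK _
      _ = _ := by
          push_cast
          rw [ENNReal.mul_rpow_of_nonneg _ _ ht.le]
          ring
  -- single shell
  have shell : ∀ j : ℕ, (∑' k, if Nat.log 4 (Nn k) = j then c k ^ 2 else 0) ≤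
      2 * (M ^ 2 * ∑' l, if 4 ^ j ≤ 4 * Nn l then a l ^ 2 else 0) +
      2 * (Kl * ((4:ℝ≥0∞) ^ j) ^ σ * Ef * ∑' m, if 4 ^ j ≤ 4 * Nn m then b m ^ 2 else 0) := by
    intro j
    set Bj := ∑' m, (if 4 ^ j ≤ 4 * Nn m then b m ^ 2 else 0) with hBj
    classical
    set S : Finset (Fin d → ℤ) :=
      (Fintype.piFinset (fun _ : Fin d => Finset.Icc (-(2:ℤ)^j) (2^j))).filter
        (fun l => 4 * Nn l ≤ 4 ^ j) with hS
    have hmem : ∀ l, l ∈ S ↔ 4 * Nn l ≤ 4 ^ j := by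
      intro l
      rw [hS, Finset.mem_filter]
      refine ⟨fun h => h.2, fun h => ⟨Nn_box l j (by omega), h⟩⟩
    obtain ⟨u, v, hc, hu, hv⟩ := H S
    have hA : (∑ l ∈ S, a l) ^ 2 ≤ Kl * ((4:ℝ≥0∞) ^ j) ^ σ * Ef := by
      refine (cs S a (fun l => (Nn l : ℝ≥0∞) ^ (-((d:ℝ)/2 - σ)))
        (fun l => (Nn l : ℝ≥0∞) ^ ((d:ℝ)/2 - σ) * a l ^ 2) ?_).trans ?_
      · intro l
        rw [← mul_assoc, ← ENNReal.rpow_add _ _ (Nn_ne l) (by simp)]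
        simp
      · refine mul_le_mul' ?_ (ENNReal.sum_le_tsum _)
        refine le_trans ?_ (hl j)
        refine le_trans (Finset.sum_le_sum fun l hlS => ?_) (ENNReal.sum_le_tsum S)
        rw [if_pos]
        have := (hmem l).1 hlS
        omega
    have hV : (∑' k, if 4 ^ j ≤ Nn k then v k ^ 2 else 0) ≤ (∑ l ∈ S, a l) ^ 2 * Bj := by
      calc _ ≤ ∑' k, (∑ l ∈ S, a l) * ∑ l ∈ S, a l *
              (if 4 ^ j ≤ 4 * Nn (k - l) then b (k - l) ^ 2 else 0) := by
            refine ENNReal.tsum_le_tsum fun k => ?_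
            split_ifs with hk
            · refine (pow_le_pow_left' (hv k) 2).trans ?_
              refine (cs S _ a (fun l => a l * b (k - l) ^ 2) ?_).trans ?_
              · intro l
                apply le_of_eq
                ring
              · gcongr with l hlS
                rw [if_pos]
                have := (hmem l).1 hlS
                have := Nn_tri k l
                omega
            · exact zero_le
        _ = (∑ l ∈ S, a l) * ∑ l ∈ S, a l * Bj := by
            rw [ENNReal.tsum_mul_left, Summable.tsum_finsetSum (fun _ _ => ENNReal.summable)]
            congr 1
            refine Finset.sum_congr rfl fun l _ => ?_
            rw [ENNReal.tsum_mul_left]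
            congr 1
            exact (Equiv.subRight l).tsum_eq (fun m => if 4 ^ j ≤ 4 * Nn m then b m ^ 2 else 0)
        _ = _ := by
            rw [← Finset.sum_mul]
            ring
    calc _ ≤ ∑' k, (2 * u k ^ 2 + 2 * (if 4 ^ j ≤ Nn k then v k ^ 2 else 0)) := by
          refine ENNReal.tsum_le_tsum fun k => ?_
          split_ifs with h1 h2 h3
          · refine (pow_le_pow_left' (hc k) 2).trans ?_
            have := ENNReal.rpow_add_le_mul_rpow_add_rpow (u k) (v k) (p := 2) (by norm_num)
            norm_num at this
            rw [← mul_add]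
            exact this
          · exfalso
            apply h2
            rw [← h1]
            exact Nat.pow_log_le_self 4 (Nn_pos k).ne'
          · exact zero_le
          · exact zero_le
      _ ≤ _ := by
          rw [ENNReal.tsum_add, ENNReal.tsum_mul_left, ENNReal.tsum_mul_left]
          refine add_le_add ?_ ?_
          · gcongr
            refine hu.trans ?_
            gcongr with l
            split_ifs with h1 h2 h2
            · exact zero_le
            · exact zero_le
            · exact le_rfl
            · exfalso
              rw [hmem] at h1
              omega
          · gcongr
            refine hV.trans ?_
            gcongr
  rw [dyad]
  calc _ ≤ ∑' j : ℕ, (4:ℝ≥0∞) ^ s * ((4:ℝ≥0∞) ^ j) ^ s *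
            ∑' k, (if Nat.log 4 (Nn k) = j then c k ^ 2 else 0) := by
        refine ENNReal.tsum_le_tsum fun j => ?_
        rw [← ENNReal.tsum_mul_left]
        refine ENNReal.tsum_le_tsum fun k => ?_
        split_ifs with h1
        · gcongr
          rw [← ENNReal.mul_rpow_of_nonneg _ _ hs.le]
          refine ENNReal.rpow_le_rpow ?_ hs.le
          have := (Nat.lt_pow_succ_log_self (b := 4) (by norm_num) (Nn k)).le
          rw [h1, pow_succ, mul_comm] at this
          exact_mod_cast this
        · simp
    _ ≤ ∑' j : ℕ, ((4:ℝ≥0∞) ^ s * 2 * M ^ 2 * (((4:ℝ≥0∞) ^ j) ^ s *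
            ∑' l, if 4 ^ j ≤ 4 * Nn l then a l ^ 2 else 0) +
          (4:ℝ≥0∞) ^ s * 2 * Kl * Ef * (((4:ℝ≥0∞) ^ j) ^ (s + σ) *
            ∑' m, if 4 ^ j ≤ 4 * Nn m then b m ^ 2 else 0)) := by
        refine ENNReal.tsum_le_tsum fun j => ?_
        refine (mul_le_mul' le_rfl (shell j)).trans (le_of_eq ?_)
        rw [ENNReal.rpow_add _ _ (by simp) (by simp)]
        ring
    _ ≤ (4:ℝ≥0∞) ^ s * 2 * M ^ 2 * ((Ka * (4:ℝ≥0∞) ^ s) * ∑' m, (Nn m : ℝ≥0∞) ^ s * a m ^ 2) +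
        (4:ℝ≥0∞) ^ s * 2 * Kl * Ef *
          ((Kb * (4:ℝ≥0∞) ^ (s + σ)) * ∑' m, (Nn m : ℝ≥0∞) ^ (s + σ) * b m ^ 2) := by
        rw [ENNReal.tsum_add, ENNReal.tsum_mul_left, ENNReal.tsum_mul_left]
        gcongr
        · exact tail s Ka hs ha a
        · exact tail (s + σ) Kb (by linarith) hb b
    _ = _ := by ring

/-- normalised measure on the circle -/
local instance instMS : MeasureSpace UnitAddCircle := ⟨AddCircle.haarAddCircle⟩

local instance instHaar : Measure.IsAddHaarMeasure (volume : Measure UnitAddCircle) :=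
  inferInstanceAs (Measure.IsAddHaarMeasure AddCircle.haarAddCircle)

local instance instProb : IsProbabilityMeasure (volume : Measure UnitAddCircle) :=
  inferInstanceAs (IsProbabilityMeasure AddCircle.haarAddCircle)

open UnitAddTorus

lemma int_cont {d : ℕ} {E : Type*} [NormedAddCommGroup E] {F : UnitAddTorus (Fin d) → E}
    (hF : Continuous F) : Integrable F (volume : Measure (UnitAddTorus (Fin d))) :=
  hF.integrable_of_hasCompactSupport (HasCompactSupport.of_compactSpace F)

lemma coeff_sub {d : ℕ} (F G : C(UnitAddTorus (Fin d), ℂ)) (k : Fin d → ℤ) :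
    mFourierCoeff (F - G) k = mFourierCoeff F k - mFourierCoeff G k := by
  unfold mFourierCoeff
  rw [← integral_sub (int_cont (by fun_prop)) (int_cont (by fun_prop))]
  simp [mul_sub]

lemma coeff_sum {d : ℕ} (S : Finset (Fin d → ℤ)) (a : (Fin d → ℤ) → ℂ)
    (G : (Fin d → ℤ) → C(UnitAddTorus (Fin d), ℂ)) (k : Fin d → ℤ) :
    mFourierCoeff (∑ l ∈ S, a l • G l : C(UnitAddTorus (Fin d), ℂ)) k
      = ∑ l ∈ S, a l * mFourierCoeff (G l) k := by
  unfold mFourierCoeff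
  simp_rw [← integral_const_mul]
  rw [← integral_finsetSum _ (fun l _ => int_cont (by fun_prop))]
  refine integral_congr_ae (Filter.Eventually.of_forall fun t => ?_)
  simp only [ContinuousMap.coe_sum, Finset.sum_apply, ContinuousMap.coe_smul, Pi.smul_apply,
    smul_eq_mul, Finset.mul_sum]
  exact Finset.sum_congr rfl fun l _ => by ring

lemma coeff_shift {d : ℕ} (G : C(UnitAddTorus (Fin d), ℂ)) (l k : Fin d → ℤ) :
    mFourierCoeff (mFourier l * G : C(UnitAddTorus (Fin d), ℂ)) k = mFourierCoeff G (k - l) := by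
  unfold mFourierCoeff
  refine integral_congr_ae (Filter.Eventually.of_forall fun t => ?_)
  simp only [ContinuousMap.mul_apply, smul_eq_mul]
  rw [← mul_assoc, ← mFourier_add]
  congr 3
  abel

lemma coeff_mono {d : ℕ} (l k : Fin d → ℤ) :
    mFourierCoeff (mFourier l : C(UnitAddTorus (Fin d), ℂ)) k = if k = l then 1 else 0 := by
  rw [← orthonormal_iff_ite.1 (orthonormal_mFourier (d := Fin d)) k l]
  rw [ContinuousMap.inner_toLp]
  unfold mFourierCoeff
  refine integral_congr_ae (Filter.Eventually.of_forall fun t => ?_)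
  simp only [mFourier_neg, smul_eq_mul]
  ring

lemma parseval_s3 {d : ℕ} (H : C(UnitAddTorus (Fin d), ℂ)) :
    ∑' k, ‖mFourierCoeff H k‖ₑ ^ 2 = ENNReal.ofReal (∫ t, ‖H t‖ ^ 2) := by
  have h := hasSum_sq_mFourierCoeff (ContinuousMap.toLp 2 volume ℂ H)
  simp only [mFourierCoeff_toLp] at h
  have h2 : ∫ t, ‖(ContinuousMap.toLp 2 volume ℂ H) t‖ ^ 2 = ∫ t, ‖H t‖ ^ 2 := by
    refine integral_congr_ae ?_
    filter_upwards [ContinuousMap.coeFn_toLp (p := 2) (𝕜 := ℂ) volume H] with t ht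
    rw [ht]
  rw [h2] at h
  rw [← h.tsum_eq, ENNReal.ofReal_tsum_of_nonneg (fun _ => by positivity) h.summable]
  refine tsum_congr fun k => ?_
  rw [← ofReal_norm, ENNReal.ofReal_pow (norm_nonneg _)]

lemma decomp {d : ℕ} (F G : C(UnitAddTorus (Fin d), ℂ)) (M : ℝ) (hM : ∀ x, ‖G x‖ ≤ M)
    (S : Finset (Fin d → ℤ)) : ∃ u v : (Fin d → ℤ) → ℝ≥0∞,
        (∀ k, ‖mFourierCoeff (F * G) k‖ₑ ≤ u k + v k) ∧
        (∑' k, u k ^ 2 ≤ ENNReal.ofReal M ^ 2 *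
          ∑' l, if l ∈ S then 0 else ‖mFourierCoeff F l‖ₑ ^ 2) ∧
        (∀ k, v k ≤ ∑ l ∈ S, ‖mFourierCoeff F l‖ₑ * ‖mFourierCoeff G (k - l)‖ₑ) := by
  have hM0 : 0 ≤ M := (norm_nonneg _).trans (hM 0)
  set L : C(UnitAddTorus (Fin d), ℂ) := ∑ l ∈ S, mFourierCoeff F l • mFourier l with hL
  have hLG : L * G = ∑ l ∈ S, mFourierCoeff F l • (mFourier l * G) := by
    rw [hL, Finset.sum_mul]
    exact Finset.sum_congr rfl fun l _ => smul_mul_assoc _ _ _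
  refine ⟨fun k => ‖mFourierCoeff ((F - L) * G : C(UnitAddTorus (Fin d), ℂ)) k‖ₑ,
    fun k => ‖mFourierCoeff (L * G : C(UnitAddTorus (Fin d), ℂ)) k‖ₑ, ?_, ?_, ?_⟩
  · intro k
    have h : (F - L) * G = F * G - L * G := by ring
    have h2 := coeff_sub (F * G) (L * G) k
    have h3 : mFourierCoeff (F * G) k = mFourierCoeff ((F - L) * G : C(UnitAddTorus (Fin d), ℂ)) k
        + mFourierCoeff (L * G : C(UnitAddTorus (Fin d), ℂ)) k := by
      rw [h]
      exact (sub_eq_iff_eq_add.1 h2.symm)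
    rw [h3]
    exact enorm_add_le _ _
  · rw [parseval_s3]
    have h1 : ∑' l, (if l ∈ S then 0 else ‖mFourierCoeff F l‖ₑ ^ 2) =
        ENNReal.ofReal (∫ t, ‖(F - L) t‖ ^ 2) := by
      rw [← parseval_s3]
      refine tsum_congr fun k => ?_
      have h2 := coeff_sub F L k
      rw [hL, coeff_sum] at h2
      simp only [coeff_mono, mul_ite, mul_one, mul_zero, Finset.sum_ite_eq] at h2
      rw [← hL] at h2
      rw [h2]
      split_ifs <;> simp
    rw [h1, ← ENNReal.ofReal_pow hM0, ← ENNReal.ofReal_mul (by positivity), ← integral_const_mul]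
    refine ENNReal.ofReal_le_ofReal ?_
    refine integral_mono (int_cont (by fun_prop)) (int_cont (by fun_prop)) fun t => ?_
    simp only [ContinuousMap.mul_apply, norm_mul, mul_pow]
    rw [mul_comm]
    have := hM t
    gcongr
  · intro k
    show ‖mFourierCoeff (L * G : C(UnitAddTorus (Fin d), ℂ)) k‖ₑ ≤ _
    rw [hLG, coeff_sum]
    refine (enorm_sum_le _ _).trans (le_of_eq ?_)
    refine Finset.sum_congr rfl fun l _ => ?_
    rw [enorm_mul, coeff_shift]

lemma lift_exists {d : ℕ} (f : Td d → ℝ) (hf : Continuous f) (hp : TPer f) :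
    ∃ F : C(UnitAddTorus (Fin d), ℂ), (∀ x : Td d, F (fun i => (x i : UnitAddCircle)) = (f x : ℂ)) := by
  have hq : IsOpenQuotientMap (Pi.map (fun (_ : Fin d) (x : ℝ) => (x : UnitAddCircle))) :=
    IsOpenQuotientMap.piMap fun _ => QuotientAddGroup.isOpenQuotientMap_mk
  have hcomp : ∀ x y : Td d, Pi.map (fun (_ : Fin d) (x : ℝ) => (x : UnitAddCircle)) x =
      Pi.map (fun (_ : Fin d) (x : ℝ) => (x : UnitAddCircle)) y → (f x : ℂ) = f y := by
    intro x y hxy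
    have : ∀ i, ∃ n : ℤ, x i = y i + n := by
      intro i
      have h := congrFun hxy i
      simp only [Pi.map_apply] at h
      rw [← sub_eq_zero, ← AddCircle.coe_sub, AddCircle.coe_eq_zero_iff] at h
      obtain ⟨n, hn⟩ := h
      refine ⟨n, ?_⟩
      simp only [zsmul_eq_mul, mul_one] at hn
      linarith
    choose n hn using this
    have h := hp y n
    rw [← h]
    congr 2
    exact funext hn
  obtain ⟨q, hsurj⟩ := hq.surjective.hasRightInverse
  have hval : ∀ x : Td d, (f (q (Pi.map (fun (_ : Fin d) (x : ℝ) => (x : UnitAddCircle)) x)) : ℂ)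
      = f x := fun x => hcomp _ _ (hsurj _)
  refine ⟨⟨fun t => (f (q t) : ℂ), ?_⟩, hval⟩
  rw [hq.isQuotientMap.continuous_iff]
  have : (fun t => (f (q t) : ℂ)) ∘ (Pi.map (fun (_ : Fin d) (x : ℝ) => (x : UnitAddCircle)))
      = fun x => (f x : ℂ) := funext hval
  rw [this]
  fun_prop

lemma fCoeff_eq {d : ℕ} (f : Td d → ℝ) (F : UnitAddTorus (Fin d) → ℂ)
    (h : ∀ x : Td d, F (fun i => (x i : UnitAddCircle)) = (f x : ℂ)) (k : Fin d → ℤ) :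
    fCoeff f k = mFourierCoeff F k := by
  rw [mFourierCoeff_eq_integral F k 0]
  unfold fCoeff
  have hb : box d = {x : Fin d → ℝ | ∀ i, x i ∈ Set.Ioc ((0 : Fin d → ℝ) i) ((0 : Fin d → ℝ) i + 1)} := by
    ext x
    simp [box]
  rw [hb]
  congr 1
  ext x
  rw [h, smul_eq_mul, mul_comm]
  congr 1
  simp only [mFourier, ContinuousMap.coe_mk, fourier_coe_apply, Pi.neg_apply]
  rw [← Complex.exp_sum, Finset.mul_sum]
  congr 1
  refine Finset.sum_congr rfl fun i _ => ?_
  push_cast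
  ring

lemma linf_bound {d : ℕ} (g : Td d → ℝ) (G : C(UnitAddTorus (Fin d), ℂ))
    (h : ∀ x : Td d, G (fun i => (x i : UnitAddCircle)) = (g x : ℂ)) (t : UnitAddTorus (Fin d)) :
    ‖G t‖ ≤ linf g := by
  have hs : ∀ i, ∃ y : ℝ, (y : UnitAddCircle) = t i := fun i => QuotientAddGroup.mk_surjective (t i)
  choose y hy using hs
  have ht : t = fun i => (y i : UnitAddCircle) := funext fun i => (hy i).symm
  have hb : BddAbove (Set.range fun x : Td d => |g x|) := by
    refine ⟨‖G‖, ?_⟩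
    rintro _ ⟨x, rfl⟩
    have := G.norm_coe_le_norm (fun i => (x i : UnitAddCircle))
    rw [h] at this
    simpa using this
  rw [ht, h]
  rw [Complex.norm_real, Real.norm_eq_abs]
  exact le_ciSup hb y

lemma hsNormSq_eq {d : ℕ} (t : ℝ) (f : Td d → ℝ) :
    hsNormSq t f = (∑' k, (Nn k : ℝ≥0∞) ^ t * ‖fCoeff f k‖ₑ ^ 2).toReal := by
  have h : ∀ k : Fin d → ℤ, (Nn k : ℝ≥0∞) ^ t * ‖fCoeff f k‖ₑ ^ 2 =
      ENNReal.ofReal (wt t k * ‖fCoeff f k‖ ^ 2) := by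
    intro k
    rw [ENNReal.ofReal_mul (by unfold wt; positivity), wt_eq, ENNReal.ofReal_pow (norm_nonneg _),
      ofReal_norm]
  simp_rw [h]
  rw [ENNReal.tsum_toReal_eq (fun _ => ENNReal.ofReal_ne_top)]
  unfold hsNormSq
  refine tsum_congr fun k => ?_
  rw [ENNReal.toReal_ofReal]
  unfold wt
  positivity

lemma InHs_fin {d : ℕ} (t : ℝ) (f : Td d → ℝ) (hf : InHs t f) :
    ∑' k, (Nn k : ℝ≥0∞) ^ t * ‖fCoeff f k‖ₑ ^ 2 ≠ ⊤ := by
  have h : ∀ k : Fin d → ℤ, (Nn k : ℝ≥0∞) ^ t * ‖fCoeff f k‖ₑ ^ 2 =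
      ENNReal.ofReal (wt t k * ‖fCoeff f k‖ ^ 2) := by
    intro k
    rw [ENNReal.ofReal_mul (by unfold wt; positivity), wt_eq, ENNReal.ofReal_pow (norm_nonneg _),
      ofReal_norm]
  simp_rw [h]
  exact hf.tsum_ofReal_ne_top

lemma est (d : ℕ) (s σ : ℝ) (hs : 0 ≤ s) (hσ : 0 < σ) (hσd : σ ≤ (d : ℝ)/2) :
    ∃ K₁ K₂ : ℝ≥0∞, K₁ ≠ ⊤ ∧ K₂ ≠ ⊤ ∧ ∀ (a b c : (Fin d → ℤ) → ℝ≥0∞) (M : ℝ≥0∞),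
      (∀ S : Finset (Fin d → ℤ), ∃ u v : (Fin d → ℤ) → ℝ≥0∞,
        (∀ k, c k ≤ u k + v k) ∧
        (∑' k, u k ^ 2 ≤ M ^ 2 * ∑' l, if l ∈ S then 0 else a l ^ 2) ∧
        (∀ k, v k ≤ ∑ l ∈ S, a l * b (k - l))) →
      ∑' k, (Nn k : ℝ≥0∞) ^ s * c k ^ 2 ≤
        K₁ * (M ^ 2 * ∑' k, (Nn k : ℝ≥0∞) ^ s * a k ^ 2) +
        K₂ * ((∑' k, (Nn k : ℝ≥0∞) ^ ((d:ℝ)/2 - σ) * a k ^ 2) *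
          ∑' k, (Nn k : ℝ≥0∞) ^ (s + σ) * b k ^ 2) := by
  rcases hs.eq_or_lt with rfl | hs
  · refine ⟨1, 0, by simp, by simp, fun a b c M H => ?_⟩
    obtain ⟨u, v, h1, h2, h3⟩ := H ∅
    simp at h2 h3
    simp only [ENNReal.rpow_zero, one_mul, zero_mul, add_zero]
    refine le_trans (ENNReal.tsum_le_tsum fun k => ?_) h2
    have := h1 k
    rw [h3 k, add_zero] at this
    gcongr
  · exact abstract_est d s σ hs hσ hσd

theorem product_estimate_refined (d : ℕ) (hd : 0 < d) (s σ : ℝ) (hs : 0 ≤ s)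
    (hσ : 0 < σ) (hσd : σ ≤ (d : ℝ)/2) :
    ∃ C > 0, ∀ f g : Td d → ℝ,
      Continuous f → TPer f → InHs s f → InHs ((d : ℝ)/2 - σ) f →
      Continuous g → TPer g → InHs (s + σ) g →
      hsNorm s (fun x => f x * g x)
        ≤ C * (hsNorm s f * linf g + hsNorm ((d : ℝ)/2 - σ) f * hsNorm (s + σ) g) := by
  obtain ⟨K₁, K₂, hK₁, hK₂, H⟩ := est d s σ hs hσ hσd
  refine ⟨√K₁.toReal + √K₂.toReal + 1, by positivity, ?_⟩
  intro f g hf hfp hfs hfσ hg hgp hgs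
  obtain ⟨F, hF⟩ := lift_exists f hf hfp
  obtain ⟨G, hG⟩ := lift_exists g hg hgp
  have hM := linf_bound g G hG
  have hM0 : 0 ≤ linf g := (norm_nonneg _).trans (hM 0)
  have hFG : ∀ x : Td d, (F * G) (fun i => (x i : UnitAddCircle)) = ((f x * g x : ℝ) : ℂ) := by
    intro x
    rw [ContinuousMap.mul_apply, hF, hG]
    push_cast
    rfl
  have key := H (fun k => ‖fCoeff f k‖ₑ) (fun k => ‖fCoeff g k‖ₑ)
    (fun k => ‖fCoeff (fun x => f x * g x) k‖ₑ) (ENNReal.ofReal (linf g)) (by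
      intro S
      simp_rw [fCoeff_eq f F hF, fCoeff_eq g G hG, fCoeff_eq _ _ hFG]
      exact decomp F G (linf g) hM S)
  have f1 := InHs_fin _ _ hfs
  have f2 := InHs_fin _ _ hfσ
  have f3 := InHs_fin _ _ hgs
  have key2 := ENNReal.toReal_mono (by finiteness) key
  rw [ENNReal.toReal_add (by finiteness) (by finiteness)] at key2
  simp only [ENNReal.toReal_mul, ENNReal.toReal_pow, ENNReal.toReal_ofReal hM0,
    ← hsNormSq_eq] at key2
  have nn : ∀ (t : ℝ) (h : Td d → ℝ), 0 ≤ hsNormSq t h := fun t h => by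
    rw [hsNormSq_eq]; exact ENNReal.toReal_nonneg
  unfold hsNorm
  set A := hsNormSq s f
  set B := hsNormSq ((d:ℝ)/2 - σ) f
  set D := hsNormSq (s + σ) g
  have hA : 0 ≤ A := nn _ _
  have hB : 0 ≤ B := nn _ _
  have hD : 0 ≤ D := nn _ _
  have k1 : 0 ≤ K₁.toReal := ENNReal.toReal_nonneg
  have k2 : 0 ≤ K₂.toReal := ENNReal.toReal_nonneg
  refine (Real.sqrt_le_sqrt key2).trans ?_
  have hadd : ∀ x y : ℝ, 0 ≤ x → 0 ≤ y → √(x + y) ≤ √x + √y := fun x y hx hy => by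
    rw [Real.sqrt_le_left (by positivity)]
    nlinarith [Real.sq_sqrt hx, Real.sq_sqrt hy, Real.sqrt_nonneg x, Real.sqrt_nonneg y,
      mul_nonneg (Real.sqrt_nonneg x) (Real.sqrt_nonneg y)]
  refine (hadd _ _ (by positivity) (by positivity)).trans ?_
  rw [Real.sqrt_mul k1, Real.sqrt_mul k2, Real.sqrt_mul (by positivity), Real.sqrt_sq hM0,
    Real.sqrt_mul hB]
  have p1 : 0 ≤ √A * linf g := by positivity
  have p2 : 0 ≤ √B * √D := by positivity
  have q1 := Real.sqrt_nonneg K₁.toReal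
  have q2 := Real.sqrt_nonneg K₂.toReal
  nlinarith [mul_nonneg q1 p2, mul_nonneg q2 p1]
end
end
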